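/- arXiv:1201.6079 — 2 statements merged into one kernel-verified Lean document; each statement's English description precedes it below -/
import Mathlib

section
/- (Existence and uniqueness for the implicit method.) For every Δt > 0 and every absolutely summable h : ℤ^d → ℝ, there exists a unique absolutely summable u : ℤ^d → ℝ that solves one implicit step with data h, i.e. such that u_α − Δt Σ_{β∈ℤ^d} G^α_β A(u_β) = h_α for every α ∈ ℤ^d. -/
open MeasureTheory Set

noncomputable section

abbrev Ed (d : ℕ) := EuclideanSpace ℝ (Fin d)

def cell (d : ℕ) (dx : ℝ) (α : Fin d → ℤ) : Set (Ed d) :=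
  {x | ∀ i, dx * (α i : ℝ) < x i ∧ x i < dx * (α i : ℝ) + dx}

def ind (d : ℕ) (S : Set (Ed d)) : Ed d → ℝ :=
  S.indicator fun _ => 1

def gam (d : ℕ) (dx : ℝ) (μ : Measure (Ed d)) (l : Fin d) : ℝ :=
  - ∫ z in {z : Ed d | dx / 2 < ‖z‖ ∧ ‖z‖ ≤ 1}, z l ∂μ

def Dup (d : ℕ) (dx : ℝ) (μ : Measure (Ed d)) (l : Fin d) (φ : Ed d → ℝ) (x : Ed d) : ℝ :=
  if 0 < gam d dx μ l then (φ (x + EuclideanSpace.single l dx) - φ x) / dx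
  else (φ x - φ (x - EuclideanSpace.single l dx)) / dx

def Glow (d : ℕ) (dx : ℝ) (μ : Measure (Ed d)) (α β : Fin d → ℤ) : ℝ :=
  (dx ^ d)⁻¹ *
    ∫ x in cell d dx α, ∫ z in {z : Ed d | dx / 2 < ‖z‖},
      (ind d (cell d dx β) (x + z) - ind d (cell d dx β) x) ∂μ

def Gup (d : ℕ) (dx : ℝ) (μ : Measure (Ed d)) (α β : Fin d → ℤ) : ℝ :=
  (dx ^ d)⁻¹ *
    ∑ l : Fin d, gam d dx μ l * ∫ x in cell d dx α, Dup d dx μ l (ind d (cell d dx β)) x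

def Gw (d : ℕ) (dx : ℝ) (μ : Measure (Ed d)) (α β : Fin d → ℤ) : ℝ :=
  Glow d dx μ α β + Gup d dx μ α β

def GsplitLow (d : ℕ) (dx r : ℝ) (μ : Measure (Ed d)) (α β : Fin d → ℤ) : ℝ :=
  (dx ^ d)⁻¹ *
    ∫ x in cell d dx α, ∫ z in {z : Ed d | dx / 2 < ‖z‖ ∧ ‖z‖ ≤ r},
      (ind d (cell d dx β) (x + z) - ind d (cell d dx β) x) ∂μ

def GsplitHigh (d : ℕ) (dx r : ℝ) (μ : Measure (Ed d)) (α β : Fin d → ℤ) : ℝ :=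
  (dx ^ d)⁻¹ *
      ∫ x in cell d dx α, ∫ z in {z : Ed d | r < ‖z‖},
        (ind d (cell d dx β) (x + z) - ind d (cell d dx β) x) ∂μ
    + Gup d dx μ α β

def Aok (A : ℝ → ℝ) (LA : ℝ) : Prop :=
  Monotone A ∧ (∀ a b : ℝ, |A a - A b| ≤ LA * |a - b|) ∧ A 0 = 0

def SolvesImplicitStep (d : ℕ) (dx : ℝ) (μ : Measure (Ed d)) (A : ℝ → ℝ) (dt : ℝ)
    (u h : (Fin d → ℤ) → ℝ) : Prop :=
  ∀ α, Summable (fun β => Gw d dx μ α β * A (u β)) ∧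
    u α - dt * ∑' β, Gw d dx μ α β * A (u β) = h α

def Fractional (d : ℕ) (μ : Measure (Ed d)) (lam clam : ℝ) : Prop :=
  ∀ B : Set (Ed d), MeasurableSet B → B ⊆ {z : Ed d | 0 < ‖z‖ ∧ ‖z‖ < 1} →
    μ B ≤ ∫⁻ z in B, ENNReal.ofReal (clam * ‖z‖ ^ (-(d : ℝ) - lam))

def Lhat (d : ℕ) (dx : ℝ) (μ : Measure (Ed d)) (w : Ed d → ℝ) (x : Ed d) : ℝ :=
  (∫ z in {z : Ed d | dx / 2 < ‖z‖}, (w (x + z) - w x) ∂μ) +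
    ∑ l : Fin d, gam d dx μ l * Dup d dx μ l w x

def Ubar (d : ℕ) (dx : ℝ) (U : (Fin d → ℤ) → ℝ) (x : Ed d) : ℝ :=
  ∑' α : Fin d → ℤ, U α * ind d (cell d dx α) x

def cellAvg (d : ℕ) (dx : ℝ) (w : Ed d → ℝ) (x : Ed d) : ℝ :=
  ∑' α : Fin d → ℤ, Set.indicator (cell d dx α)
    (fun _ => (dx ^ d)⁻¹ * ∫ y in cell d dx α, w y) x


/-- A matrix with nonnegative off-diagonal entries, nonpositive (finite) column sums and bounded
diagonal: the algebraic content of a monotone conservative discretization. -/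
structure IsMonotoneStencil {ι : Type*} (G : ι → ι → ℝ) (C : ℝ) : Prop where
  off_diag_nonneg : ∀ α β, α ≠ β → 0 ≤ G α β
  neg_le_diag : ∀ β, -C ≤ G β β
  sum_nonpos : ∀ (s : Finset ι) (β : ι), β ∈ s → ∑ α ∈ s, G α β ≤ 0

namespace IsMonotoneStencil

variable {ι : Type*} {G : ι → ι → ℝ} {C : ℝ}

lemma diag_nonpos (hG : IsMonotoneStencil G C) (β : ι) : G β β ≤ 0 := by
  simpa using hG.sum_nonpos {β} β (by simp)

lemma bound_nonneg (hG : IsMonotoneStencil G C) (β : ι) : 0 ≤ C := by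
  linarith [hG.diag_nonpos β, hG.neg_le_diag β]

lemma sum_abs_le (hG : IsMonotoneStencil G C) (β : ι) (s : Finset ι) :
    ∑ α ∈ s, |G α β| ≤ 2 * C := by
  classical
  have hpt : ∀ α, |G α β| ≤ G α β + if α = β then 2 * C else 0 := by
    intro α
    split_ifs with h
    · subst h
      rw [abs_of_nonpos (hG.diag_nonpos α)]
      linarith [hG.neg_le_diag α]
    · rw [abs_of_nonneg (hG.off_diag_nonneg α β h), add_zero]
  calc ∑ α ∈ s, |G α β| ≤ ∑ α ∈ insert β s, |G α β| :=
        Finset.sum_le_sum_of_subset_of_nonneg (Finset.subset_insert _ _)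
          fun _ _ _ => abs_nonneg _
    _ ≤ ∑ α ∈ insert β s, (G α β + if α = β then 2 * C else 0) :=
        Finset.sum_le_sum fun α _ => hpt α
    _ ≤ 2 * C := by
        rw [Finset.sum_add_distrib, Finset.sum_ite_eq' (insert β s) β]
        simpa using hG.sum_nonpos (insert β s) β (by simp)

lemma summable_col_abs (hG : IsMonotoneStencil G C) (β : ι) : Summable fun α => |G α β| :=
  summable_of_sum_le (fun _ => abs_nonneg _) (hG.sum_abs_le β)

lemma tsum_col_nonpos (hG : IsMonotoneStencil G C) (β : ι) : ∑' α, G α β ≤ 0 := by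
  classical
  have h := (hG.summable_col_abs β).of_abs.hasSum
  refine le_of_tendsto h ?_
  filter_upwards [Filter.eventually_ge_atTop ({β} : Finset ι)] with s hs
  exact hG.sum_nonpos s β (hs (by simp))

lemma summable_prod (hG : IsMonotoneStencil G C) {w : ι → ℝ} (hw : Summable fun β => |w β|) :
    Summable fun p : ι × ι => G p.1 p.2 * w p.2 := by
  have hcol : ∀ β, Summable fun α => |G α β| * |w β| := fun β =>
    (hG.summable_col_abs β).mul_right |w β|
  have hcols : Summable fun β => ∑' α, |G α β| * |w β| := by
    refine .of_nonneg_of_le (fun β => tsum_nonneg fun α => by positivity)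
      (fun β => ?_) (hw.mul_left (2 * C))
    rw [tsum_mul_right]
    exact mul_le_mul_of_nonneg_right
      (Real.tsum_le_of_sum_le (fun _ => abs_nonneg _) (hG.sum_abs_le β)) (abs_nonneg _)
  have : Summable fun p : ι × ι => |G p.2 p.1| * |w p.1| :=
    (summable_prod_of_nonneg fun _ => mul_nonneg (abs_nonneg _) (abs_nonneg _)).2 ⟨hcol, hcols⟩
  exact summable_abs_iff.1 (this.prod_symm.congr fun p => (abs_mul _ _).symm)

lemma summable_row (hG : IsMonotoneStencil G C) {w : ι → ℝ} (hw : Summable fun β => |w β|)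
    (α : ι) : Summable fun β => G α β * w β :=
  (hG.summable_prod hw).prod_factor α

lemma summable_apply (hG : IsMonotoneStencil G C) {w : ι → ℝ} (hw : Summable fun β => |w β|) :
    Summable fun α => ∑' β, G α β * w β :=
  (hG.summable_prod hw).prod

lemma tsum_apply_nonpos (hG : IsMonotoneStencil G C) {w : ι → ℝ}
    (hw : Summable fun β => |w β|) (hw0 : ∀ β, 0 ≤ w β) :
    ∑' α, ∑' β, G α β * w β ≤ 0 := by
  have hs : Summable (Function.uncurry fun α β => G α β * w β) := hG.summable_prod hw
  rw [← hs.tsum_comm]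
  refine tsum_nonpos fun β => ?_
  rw [tsum_mul_right]
  exact mul_nonpos_of_nonpos_of_nonneg (hG.tsum_col_nonpos β) (hw0 β)

/-- If `x` and `a α` have the same sign and `x` dominates the diagonal contribution, then the
off-diagonal part is the only loss in the triangle inequality. -/
lemma abs_add_tsum_le (hG : IsMonotoneStencil G C) {a : ι → ℝ} (ha : Summable fun β => |a β|)
    (α : ι) {x c : ℝ} (hc : 0 ≤ c) (hx : |x + c * (G α α * a α)| = |x| + c * (G α α * |a α|)) :
    |x + c * ∑' β, G α β * a β| ≤ |x| + c * ∑' β, G α β * |a β| := by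
  classical
  have ha' : Summable fun β => |(|a β|)| := by simpa using ha
  have h1 := hG.summable_row ha α
  have h2 := hG.summable_row ha' α
  rw [h1.tsum_eq_add_tsum_ite α, h2.tsum_eq_add_tsum_ite α]
  have h4 : ∀ β, ‖(if β = α then 0 else G α β * a β)‖ = if β = α then 0 else G α β * |a β| := by
    intro β
    split_ifs with h
    · simp
    · rw [Real.norm_eq_abs, abs_mul, abs_of_nonneg (hG.off_diag_nonneg α β (Ne.symm h))]
  have h3 : Summable fun β => if β = α then 0 else G α β * |a β| := by
    refine (h2.norm).of_norm_bounded fun β => ?_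
    split_ifs with h
    · simpa using by positivity
    · exact le_rfl
  have h5 : |∑' β, if β = α then 0 else G α β * a β| ≤
      ∑' β, if β = α then 0 else G α β * |a β| := by
    simp_rw [← h4] at h3 ⊢
    exact norm_tsum_le_tsum_norm h3
  calc _ = |(x + c * (G α α * a α)) + c * ∑' β, if β = α then 0 else G α β * a β| := by
        congr 1; ring
    _ ≤ |x + c * (G α α * a α)| + |c * ∑' β, if β = α then 0 else G α β * a β| := abs_add_le _ _
    _ ≤ (|x| + c * (G α α * |a α|)) + c * ∑' β, if β = α then 0 else G α β * |a β| := by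
        rw [hx, abs_mul, abs_of_nonneg hc]
        gcongr
    _ = _ := by ring

lemma add {H : ι → ι → ℝ} {D : ℝ}
    (hG : IsMonotoneStencil G C) (hH : IsMonotoneStencil H D) :
    IsMonotoneStencil (fun α β => G α β + H α β) (C + D) where
  off_diag_nonneg α β h := add_nonneg (hG.off_diag_nonneg α β h) (hH.off_diag_nonneg α β h)
  neg_le_diag β := by linarith [hG.neg_le_diag β, hH.neg_le_diag β]
  sum_nonpos s β h := by
    rw [Finset.sum_add_distrib]
    linarith [hG.sum_nonpos s β h, hH.sum_nonpos s β h]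

lemma const_mul {c : ℝ}
    (hG : IsMonotoneStencil G C) (hc : 0 ≤ c) :
    IsMonotoneStencil (fun α β => c * G α β) (c * C) where
  off_diag_nonneg α β h := mul_nonneg hc (hG.off_diag_nonneg α β h)
  neg_le_diag β := by nlinarith [hG.neg_le_diag β]
  sum_nonpos s β h := by
    rw [← Finset.mul_sum]
    exact mul_nonpos_of_nonneg_of_nonpos hc (hG.sum_nonpos s β h)

lemma sum {κ : Type*} (t : Finset κ) {G : κ → ι → ι → ℝ} {C : κ → ℝ}
    (hG : ∀ k, IsMonotoneStencil (G k) (C k)) :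
    IsMonotoneStencil (fun α β => ∑ k ∈ t, G k α β) (∑ k ∈ t, C k) where
  off_diag_nonneg α β h := Finset.sum_nonneg fun k _ => (hG k).off_diag_nonneg α β h
  neg_le_diag β := by
    rw [← Finset.sum_neg_distrib]
    exact Finset.sum_le_sum fun k _ => (hG k).neg_le_diag β
  sum_nonpos s β h := by
    rw [Finset.sum_comm]
    exact Finset.sum_nonpos fun k _ => (hG k).sum_nonpos s β h

end IsMonotoneStencil

lemma memℓp_one_iff {ι : Type*} {u : ι → ℝ} :
    Memℓp (E := fun _ : ι => ℝ) u 1 ↔ Summable fun α => |u α| := by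
  rw [memℓp_gen_iff (by simp)]
  simp

lemma norm_lp_one {ι : Type*} (u : lp (fun _ : ι => ℝ) 1) : ‖u‖ = ∑' α, |u α| := by
  rw [lp.norm_eq_tsum_rpow (by simp)]
  simp

/-- One implicit step for a monotone stencil is uniquely solvable in `ℓ¹`. The solution is the fixed
point of `u ↦ u - ε (u - dt G A(u) - h)`, which is a contraction for small `ε`. -/
theorem IsMonotoneStencil.existsUnique_implicit {ι : Type*} {G : ι → ι → ℝ} {C : ℝ}
    (hG : IsMonotoneStencil G C) {A : ℝ → ℝ} {LA : ℝ} (hA : Aok A LA) {dt : ℝ} (hdt : 0 < dt)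
    {h : ι → ℝ} (hh : Summable fun α => |h α|) :
    ∃! u : ι → ℝ, (Summable fun α => |u α|) ∧ ∀ α,
      (Summable fun β => G α β * A (u β)) ∧ u α - dt * ∑' β, G α β * A (u β) = h α := by
  obtain ⟨hmono, hlip, hA0⟩ := hA
  rcases isEmpty_or_nonempty ι with hι | ⟨⟨β₀⟩⟩
  · exact ⟨fun _ => 0, ⟨by simp, fun α => hι.elim α⟩, fun v _ => funext fun α => hι.elim α⟩
  have hC : 0 ≤ C := hG.bound_nonneg β₀
  have hLA : 0 ≤ LA := by simpa using (abs_nonneg _).trans (hlip 1 0)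
  have hAs : ∀ u : ι → ℝ, (Summable fun α => |u α|) → Summable fun α => |A (u α)| := fun u hu =>
    .of_nonneg_of_le (fun _ => abs_nonneg _)
      (fun α => by simpa [hA0] using hlip (u α) 0) (hu.mul_left LA)
  set ε : ℝ := 1 / (1 + dt * LA * C) with hε
  have hden : 0 < 1 + dt * LA * C := by positivity
  have hε0 : 0 < ε := by positivity
  have hε1 : ε ≤ 1 := by
    rw [hε, div_le_one hden]
    have : 0 ≤ dt * LA * C := by positivity
    linarith
  have hεeq : ε * (dt * LA * C) = 1 - ε := by
    rw [hε]; field_simp; ring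
  let F : (ι → ℝ) → ι → ℝ := fun u α =>
    (1 - ε) * u α + ε * dt * (∑' β, G α β * A (u β)) + ε * h α
  have hF : ∀ u : ι → ℝ, (Summable fun α => |u α|) → Summable fun α => |F u α| := fun u hu =>
    (((hu.of_abs.mul_left _).add ((hG.summable_apply (hAs u hu)).mul_left _)).add
      (hh.of_abs.mul_left _)).abs
  let T : lp (fun _ : ι => ℝ) 1 → lp (fun _ : ι => ℝ) 1 := fun u =>
    ⟨F u, memℓp_one_iff.2 (hF u (memℓp_one_iff.1 u.2))⟩
  have hfix : ∀ u : ι → ℝ, F u = u ↔ ∀ α, u α - dt * ∑' β, G α β * A (u β) = h α := by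
    intro u
    rw [funext_iff]
    refine forall_congr' fun α => ?_
    have : F u α - u α = -ε * (u α - dt * (∑' β, G α β * A (u β)) - h α) := by
      simp only [F]; ring
    rw [← sub_eq_zero, this, ← sub_eq_zero (b := h α)]
    simp [hε0.ne']
  obtain ⟨K, hK⟩ : ∃ K : NNReal, (K : ℝ) = 1 - ε := ⟨⟨1 - ε, by linarith⟩, rfl⟩
  have hcontr : ContractingWith K T := by
    refine ⟨by rw [← NNReal.coe_lt_coe, hK]; simpa using hε0, LipschitzWith.of_dist_le_mul fun u v => ?_⟩
    have hu := memℓp_one_iff.1 u.2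
    have hv := memℓp_one_iff.1 v.2
    set a : ι → ℝ := fun α => A (u α) - A (v α) with ha_def
    have ha : Summable fun α => |a α| := ((hAs u hu).of_abs.sub (hAs v hv).of_abs).abs
    have ha' : Summable fun β => |(|a β|)| := by simpa using ha
    have hD : Summable fun α => |u α - v α| := (hu.of_abs.sub hv.of_abs).abs
    have hpt : ∀ α, |F u α - F v α| ≤
        (1 - ε) * |u α - v α| + ε * dt * ∑' β, G α β * |a β| := by
      intro α
      have e1 : F u α - F v α = (1 - ε) * (u α - v α) + ε * dt * ∑' β, G α β * a β := by
        have : ∑' β, G α β * a β = ∑' β, G α β * A (u β) - ∑' β, G α β * A (v β) := by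
          rw [← (hG.summable_row (hAs u hu) α).tsum_sub (hG.summable_row (hAs v hv) α)]
          simp [ha_def, mul_sub]
        rw [this]; simp only [F]; ring
      have e2 : (1 - ε) * |u α - v α| = |(1 - ε) * (u α - v α)| := by
        rw [abs_mul, abs_of_nonneg (by linarith : 0 ≤ 1 - ε)]
      rw [e1, e2]
      refine hG.abs_add_tsum_le ha α (by positivity) ?_
      have hsmall : ε * dt * (-G α α) * |a α| ≤ (1 - ε) * |u α - v α| := by
        calc ε * dt * (-G α α) * |a α| ≤ ε * dt * C * (LA * |u α - v α|) := by
              gcongr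
              · linarith [hG.neg_le_diag α]
              · exact hlip _ _
          _ = ε * (dt * LA * C) * |u α - v α| := by ring
          _ = _ := by rw [hεeq]
      rw [← e2]
      have h1ε : 0 ≤ 1 - ε := by linarith
      rcases le_total (v α) (u α) with hle | hle
      · have ha0 : 0 ≤ a α := sub_nonneg.2 (hmono hle)
        rw [abs_of_nonneg ha0, abs_of_nonneg (sub_nonneg.2 hle)] at *
        rw [abs_of_nonneg (by linarith)]
      · have ha0 : a α ≤ 0 := sub_nonpos.2 (hmono hle)
        rw [abs_of_nonpos ha0, abs_of_nonpos (sub_nonpos.2 hle)] at *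
        rw [abs_of_nonpos (by linarith)]
        ring
    have hR : Summable fun α => ∑' β, G α β * |a β| := hG.summable_apply ha'
    have key : ∑' α, |F u α - F v α| ≤ (1 - ε) * ∑' α, |u α - v α| := by
      calc ∑' α, |F u α - F v α|
          ≤ ∑' α, ((1 - ε) * |u α - v α| + ε * dt * ∑' β, G α β * |a β|) :=
            ((hF u hu).of_abs.sub (hF v hv).of_abs).abs.tsum_le_tsum hpt
              ((hD.mul_left _).add (hR.mul_left _))
        _ = (1 - ε) * ∑' α, |u α - v α| + ε * dt * ∑' α, ∑' β, G α β * |a β| := by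
            rw [(hD.mul_left _).tsum_add (hR.mul_left _), tsum_mul_left, tsum_mul_left]
        _ ≤ _ := by
            have := hG.tsum_apply_nonpos ha' fun β => abs_nonneg _
            have h' : ε * dt * ∑' α, ∑' β, G α β * |a β| ≤ 0 :=
              mul_nonpos_of_nonneg_of_nonpos (by positivity) this
            linarith
    rw [hK, dist_eq_norm, dist_eq_norm, norm_lp_one, norm_lp_one]
    exact key
  have hmem := memℓp_one_iff.1 (hcontr.fixedPoint T).2
  refine ⟨(hcontr.fixedPoint T : lp (fun _ : ι => ℝ) 1), ⟨hmem, fun α => ⟨hG.summable_row (hAs _ hmem) α, ?_⟩⟩, ?_⟩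
  · exact (hfix _).1 (congrArg Subtype.val hcontr.fixedPoint_isFixedPt) α
  · rintro v ⟨hv, hsol⟩
    have h1 : F v = v := (hfix v).2 fun α => (hsol α).2
    have h2 : Function.IsFixedPt T ⟨v, memℓp_one_iff.2 hv⟩ := Subtype.ext h1
    exact congrArg Subtype.val (hcontr.fixedPoint_unique h2)

lemma measurableSet_cell (d : ℕ) (dx : ℝ) (α : Fin d → ℤ) : MeasurableSet (cell d dx α) := by
  have : cell d dx α =
      ⋂ i, {x : Ed d | dx * (α i : ℝ) < x i} ∩ {x : Ed d | x i < dx * (α i : ℝ) + dx} := by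
    ext x
    simp [cell]
  rw [this]
  refine MeasurableSet.iInter fun i => ?_
  exact (measurableSet_lt measurable_const (by fun_prop)).inter
    (measurableSet_lt (by fun_prop) measurable_const)

lemma disjoint_cell {d : ℕ} {dx : ℝ} (hdx : 0 < dx) {α β : Fin d → ℤ} (h : α ≠ β) :
    Disjoint (cell d dx α) (cell d dx β) := by
  rw [Set.disjoint_left]
  intro x hx hy
  refine h (funext fun i => ?_)
  have h1 : (α i : ℝ) < β i + 1 := by
    have := (hx i).1.trans (hy i).2
    rw [← mul_add_one] at this
    exact lt_of_mul_lt_mul_left this hdx.le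
  have h2 : (β i : ℝ) < α i + 1 := by
    have := (hy i).1.trans (hx i).2
    rw [← mul_add_one] at this
    exact lt_of_mul_lt_mul_left this hdx.le
  norm_cast at h1 h2
  omega

lemma volume_cell_lt_top (d : ℕ) (dx : ℝ) (α : Fin d → ℤ) : volume (cell d dx α) < ⊤ := by
  have hsub : cell d dx α ⊆ (WithLp.ofLp : Ed d → Fin d → ℝ) ⁻¹'
      Set.Icc (fun i => dx * (α i : ℝ)) (fun i => dx * (α i : ℝ) + dx) :=
    fun x hx => ⟨fun i => (hx i).1.le, fun i => (hx i).2.le⟩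
  refine (measure_mono hsub).trans_lt ?_
  rw [(PiLp.volume_preserving_ofLp (Fin d)).measure_preimage measurableSet_Icc.nullMeasurableSet]
  exact isCompact_Icc.measure_lt_top

lemma volume_cell_eq (d : ℕ) (dx : ℝ) (α : Fin d → ℤ) :
    volume (cell d dx α) = volume (cell d dx 0) := by
  have : cell d dx α = (fun x => x + WithLp.toLp 2 fun i => -(dx * (α i : ℝ))) ⁻¹' cell d dx 0 := by
    ext x
    simp only [cell, Set.mem_ofPred_eq, Set.mem_preimage, PiLp.add_apply, Pi.zero_apply]
    refine forall_congr' fun i => ?_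
    constructor <;> rintro ⟨h1, h2⟩ <;> constructor <;> push_cast at * <;> linarith
  rw [this, measure_preimage_add_right]

lemma measurable_ind {d : ℕ} {S : Set (Ed d)} (hS : MeasurableSet S) : Measurable (ind d S) :=
  measurable_const.indicator hS

lemma ind_nonneg {d : ℕ} (S : Set (Ed d)) (x : Ed d) : 0 ≤ ind d S x :=
  Set.indicator_nonneg (fun _ _ => zero_le_one) x

lemma ind_le_one {d : ℕ} (S : Set (Ed d)) (x : Ed d) : ind d S x ≤ 1 :=
  Set.indicator_le_self' (fun _ _ => zero_le_one) x

lemma abs_ind_sub_ind_le {d : ℕ} (S : Set (Ed d)) (x y : Ed d) : |ind d S x - ind d S y| ≤ 1 := by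
  rw [abs_le]
  constructor <;> linarith [ind_nonneg S x, ind_le_one S x, ind_nonneg S y, ind_le_one S y]

lemma integrable_ind {d : ℕ} {S : Set (Ed d)} (hS : MeasurableSet S) (hv : volume S < ⊤) :
    Integrable (ind d S) :=
  (integrable_indicator_iff hS).2 (integrableOn_const hv.ne)

/-- The translate of `S` covers at most as much of a superset `U` of `S` as `S` itself. -/
lemma setIntegral_ind_add_sub_nonpos {d : ℕ} {S U : Set (Ed d)} (hS : MeasurableSet S)
    (hv : volume S < ⊤) (hSU : S ⊆ U) (v : Ed d) :
    ∫ x in U, (ind d S (x + v) - ind d S x) ≤ 0 := by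
  have h1 := integrable_ind hS hv
  have h2 : Integrable fun x => ind d S (x + v) := h1.comp_add_right v
  rw [integral_sub h2.integrableOn h1.integrableOn, sub_nonpos]
  calc ∫ x in U, ind d S (x + v) ≤ ∫ x, ind d S (x + v) :=
        setIntegral_le_integral h2 (Filter.Eventually.of_forall fun _ => ind_nonneg _ _)
    _ = ∫ x, ind d S x := integral_add_right_eq_self _ v
    _ = ∫ x in U, ind d S x :=
        (setIntegral_eq_integral_of_forall_compl_eq_zero fun x hx =>
          Set.indicator_of_notMem (fun h => hx (hSU h)) _).symm

lemma measure_setOf_lt_norm_lt_top {d : ℕ} {μ : Measure (Ed d)}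
    (hμ : ∫⁻ z, ENNReal.ofReal (min (‖z‖ ^ 2) 1) ∂μ < ⊤) {r : ℝ} (hr : 0 < r) :
    μ {z : Ed d | r < ‖z‖} < ⊤ := by
  have hpos : 0 < min (r ^ 2) 1 := lt_min (by positivity) one_pos
  have hsub : {z : Ed d | r < ‖z‖} ⊆
      {z | ENNReal.ofReal (min (r ^ 2) 1) ≤ ENNReal.ofReal (min (‖z‖ ^ 2) 1)} := by
    intro z hz
    have hz' : r < ‖z‖ := hz
    exact ENNReal.ofReal_le_ofReal (min_le_min_right _ (by gcongr))
  have hne : ENNReal.ofReal (min (r ^ 2) 1) ≠ 0 := (ENNReal.ofReal_pos.2 hpos).ne'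
  exact (measure_mono hsub).trans_lt
    ((meas_ge_le_lintegral_div (by fun_prop) hne ENNReal.ofReal_ne_top).trans_lt
      (ENNReal.div_lt_top hμ.ne hne))

/-- Nonlocal difference of the indicator of a cell, integrated against a finite measure. -/
lemma integrable_ind_add_sub {d : ℕ} {S U : Set (Ed d)} (hS : MeasurableSet S)
    (hU : volume U < ⊤) (ν : Measure (Ed d)) [IsFiniteMeasure ν] :
    Integrable (Function.uncurry fun x z => ind d S (x + z) - ind d S x)
      ((volume.restrict U).prod ν) := by
  have : IsFiniteMeasure (volume.restrict U) := ⟨by simpa using hU⟩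
  have hm := measurable_ind hS
  refine Integrable.of_bound (C := 1) (Measurable.aestronglyMeasurable ?_)
    (Filter.Eventually.of_forall fun p => abs_ind_sub_ind_le S _ _)
  exact (hm.comp (measurable_fst.add measurable_snd)).sub (hm.comp measurable_fst)

/-- Averaging the nonlocal difference of cell indicators over cells yields a monotone stencil. -/
lemma isMonotoneStencil_integral_ind_add_sub {d : ℕ} {dx : ℝ} (hdx : 0 < dx)
    (ν : Measure (Ed d)) [IsFiniteMeasure ν] :
    IsMonotoneStencil (fun α β : Fin d → ℤ => ∫ x in cell d dx α,
        ∫ z, (ind d (cell d dx β) (x + z) - ind d (cell d dx β) x) ∂ν)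
      (ν.real Set.univ * volume.real (cell d dx 0)) where
  off_diag_nonneg α β h := by
    refine setIntegral_nonneg (measurableSet_cell d dx α) fun x hx => integral_nonneg fun z => ?_
    have : ind d (cell d dx β) x = 0 :=
      Set.indicator_of_notMem (Set.disjoint_left.1 (disjoint_cell hdx h) hx) _
    simpa [this] using ind_nonneg _ _
  neg_le_diag β := by
    have h := norm_setIntegral_le_of_norm_le_const (C := ν.real Set.univ)
      (f := fun x => ∫ z, (ind d (cell d dx β) (x + z) - ind d (cell d dx β) x) ∂ν)
      (volume_cell_lt_top d dx β) fun x _ => by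
        simpa using norm_integral_le_of_norm_le_const (μ := ν) (C := 1)
          (f := fun z => ind d (cell d dx β) (x + z) - ind d (cell d dx β) x)
          (Filter.Eventually.of_forall fun z => abs_ind_sub_ind_le (cell d dx β) (x + z) x)
    rw [measureReal_def volume, volume_cell_eq] at h
    exact (abs_le.1 h).1
  sum_nonpos s β hβ := by
    have hvol : volume (⋃ α ∈ s, cell d dx α) < ⊤ :=
      measure_biUnion_lt_top s.finite_toSet fun α _ => volume_cell_lt_top d dx α
    have hint (U : Set (Ed d)) (hU : volume U < ⊤) :=
      integrable_ind_add_sub (measurableSet_cell d dx β) hU ν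
    rw [← integral_biUnion_finset s (fun α _ => measurableSet_cell d dx α)
      (fun α _ γ _ h => disjoint_cell hdx h)
      (f := fun x => ∫ z, (ind d (cell d dx β) (x + z) - ind d (cell d dx β) x) ∂ν)
      (fun α _ => (hint _ (volume_cell_lt_top d dx α)).integral_prod_left),
      integral_integral_swap (hint _ hvol)]
    exact integral_nonpos fun z => setIntegral_ind_add_sub_nonpos (measurableSet_cell d dx β)
      (volume_cell_lt_top d dx β) (Set.subset_biUnion_of_mem (u := cell d dx) hβ) z

lemma isMonotoneStencil_Glow {d : ℕ} {dx : ℝ} (hdx : 0 < dx) {μ : Measure (Ed d)}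
    (hμ : ∫⁻ z, ENNReal.ofReal (min (‖z‖ ^ 2) 1) ∂μ < ⊤) :
    ∃ C, IsMonotoneStencil (Glow d dx μ) C := by
  have : IsFiniteMeasure (μ.restrict {z : Ed d | dx / 2 < ‖z‖}) :=
    ⟨by simpa using measure_setOf_lt_norm_lt_top hμ (half_pos hdx)⟩
  exact ⟨_, (isMonotoneStencil_integral_ind_add_sub hdx
    (μ.restrict {z : Ed d | dx / 2 < ‖z‖})).const_mul (by positivity)⟩

lemma isMonotoneStencil_Gup {d : ℕ} {dx : ℝ} (hdx : 0 < dx) (μ : Measure (Ed d)) :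
    ∃ C, IsMonotoneStencil (Gup d dx μ) C := by
  let v : Fin d → Ed d := fun l =>
    if 0 < gam d dx μ l then EuclideanSpace.single l dx else -EuclideanSpace.single l dx
  have hDup : ∀ (l : Fin d) (φ : Ed d → ℝ) (x : Ed d), gam d dx μ l * Dup d dx μ l φ x =
      |gam d dx μ l| / dx * (φ (x + v l) - φ x) := by
    intro l φ x
    by_cases h : 0 < gam d dx μ l
    · simp only [Dup, v, if_pos h, abs_of_pos h]
      ring
    · simp only [Dup, v, if_neg h, abs_of_nonpos (not_lt.1 h), ← sub_eq_add_neg]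
      ring
  have hGup : Gup d dx μ = fun α β => (dx ^ d)⁻¹ * ∑ l : Fin d, |gam d dx μ l| / dx *
      ∫ x in cell d dx α, ∫ z,
        (ind d (cell d dx β) (x + z) - ind d (cell d dx β) x) ∂(Measure.dirac (v l)) := by
    funext α β
    simp only [Gup, ← integral_const_mul, hDup, integral_dirac]
  rw [hGup]
  exact ⟨_, (IsMonotoneStencil.sum Finset.univ fun l =>
    (isMonotoneStencil_integral_ind_add_sub hdx (Measure.dirac (v l))).const_mul
      (div_nonneg (abs_nonneg (gam d dx μ l)) hdx.le)).const_mul (by positivity)⟩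

theorem stmt12 (d : ℕ) (hd : 1 ≤ d) (dx : ℝ) (hdx0 : 0 < dx) (hdx1 : dx < 1)
    (μ : Measure (Ed d)) (hμ0 : μ {0} = 0)
    (hμfin : ∫⁻ z, ENNReal.ofReal (min (‖z‖ ^ 2) 1) ∂μ < ⊤)
    (A : ℝ → ℝ) (LA : ℝ) (hA : Aok A LA) :
    ∀ (dt : ℝ), 0 < dt → ∀ h : (Fin d → ℤ) → ℝ, (Summable fun α => |h α|) →
      ∃! u : (Fin d → ℤ) → ℝ,
        (Summable fun α => |u α|) ∧ SolvesImplicitStep d dx μ A dt u h := by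
  intro dt hdt h hh
  obtain ⟨C, hC⟩ := isMonotoneStencil_Glow hdx0 hμfin
  obtain ⟨D, hD⟩ := isMonotoneStencil_Gup hdx0 μ
  have hG : IsMonotoneStencil (Gw d dx μ) (C + D) := hC.add hD
  exact hG.existsUnique_implicit hA hdt hh
end
end

section
/- (L¹ bound on the discretized Lévy operator.) Define, for w ∈ L¹(ℝ^d), the discretized Lévy operator L̂^μ[w](x) = ∫_{|z|>Δx/2} (w(x+z) − w(x)) dμ(z) + Σ_{l=1}^d γ_l D^γ_l w(x). There is a constant C > 0 depending only on d such that: if w ∈ L¹(ℝ^d) and K ≥ 0 satisfies ∫_{ℝ^d} |w(x+h) − w(x)| dx ≤ K|h| for all h ∈ ℝ^d, then L̂^μ[w] is defined almost everywhere, belongs to L¹(ℝ^d), and ‖L̂^μ[w]‖_{L¹(ℝ^d)} ≤ C (K + ‖w‖_{L¹(ℝ^d)}) Δx^{−1} ∫_{ℝ^d} min(|z|²,1) dμ(z). -/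
open MeasureTheory Set

noncomputable section

/-- The difference of `w` and its translates is jointly integrable against a finite measure. -/
theorem integrable_prod_translate_sub {d : ℕ} (ν : Measure (Ed d)) [IsFiniteMeasure ν]
    {w : Ed d → ℝ} (hw : Integrable w) :
    Integrable (fun p : Ed d × Ed d => w (p.2 + p.1) - w p.2) (ν.prod volume) := by
  have hadd : Measure.QuasiMeasurePreserving (fun p : Ed d × Ed d => p.2 + p.1)
      (ν.prod volume) volume := by
    have h := Measure.quasiMeasurePreserving_snd.comp
      (measurePreserving_prod_add ν (volume : Measure (Ed d))).quasiMeasurePreserving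
    simpa only [Function.comp_def, add_comm] using h
  have hm : AEStronglyMeasurable (fun p : Ed d × Ed d => w (p.2 + p.1)) (ν.prod volume) :=
    hw.aestronglyMeasurable.comp_quasiMeasurePreserving hadd
  have hi : Integrable (fun p : Ed d × Ed d => w (p.2 + p.1)) (ν.prod volume) := by
    refine (integrable_prod_iff hm).2 ⟨.of_forall fun z => hw.comp_add_right z, ?_⟩
    have h : (fun z : Ed d => ∫ x, ‖w (x + z)‖) = fun _ => ∫ x, ‖w x‖ :=
      funext fun z => integral_add_right_eq_self (fun x => ‖w x‖) z
    simpa only [h] using integrable_const _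
  exact hi.sub (hw.comp_snd ν)

/-- Minkowski's integral inequality for the `L¹` norm of an average of translation differences. -/
theorem integral_abs_integral_translate_sub_le {d : ℕ} (ν : Measure (Ed d)) [IsFiniteMeasure ν]
    {w : Ed d → ℝ} (hw : Integrable w) :
    Integrable (fun x => ∫ z, (w (x + z) - w x) ∂ν) ∧
      ∫ x, |∫ z, (w (x + z) - w x) ∂ν| ≤ ∫ z, (∫ x, |w (x + z) - w x|) ∂ν := by
  have hF := integrable_prod_translate_sub ν hw
  refine ⟨hF.integral_prod_right, ?_⟩
  rw [integral_integral_swap (μ := ν) (ν := volume) (f := fun z x => |w (x + z) - w x|) hF.abs]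
  exact integral_mono hF.integral_prod_right.abs hF.abs.integral_prod_right
    fun x => abs_integral_le_integral_abs

theorem integral_abs_translate_sub_le {d : ℕ} {w : Ed d → ℝ} (hw : Integrable w) (h : Ed d) :
    ∫ x, |w (x + h) - w x| ≤ 2 * ∫ x, |w x| := by
  have hadd : ∫ x, |w (x + h)| = ∫ x, |w x| := integral_add_right_eq_self (fun x => |w x|) h
  calc ∫ x, |w (x + h) - w x|
      ≤ ∫ x, (|w (x + h)| + |w x|) :=
        integral_mono ((hw.comp_add_right h).sub hw).abs
          ((hw.comp_add_right h).abs.add hw.abs) fun x => abs_sub _ _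
    _ = 2 * ∫ x, |w x| := by
        rw [integral_add (hw.comp_add_right h).abs hw.abs, hadd, two_mul]

theorem integrable_min_sq {d : ℕ} {μ : Measure (Ed d)}
    (hμ : ∫⁻ z, ENNReal.ofReal (min (‖z‖ ^ 2) 1) ∂μ < ⊤) :
    Integrable (fun z : Ed d => min (‖z‖ ^ 2) 1) μ := by
  refine ⟨by fun_prop, ?_⟩
  rwa [hasFiniteIntegral_iff_ofReal (.of_forall fun z => by positivity)]

/-- Outside a ball around the origin, a Lévy measure is finite. -/
theorem measure_norm_gt_lt_top {d : ℕ} {μ : Measure (Ed d)}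
    (hμ : Integrable (fun z : Ed d => min (‖z‖ ^ 2) 1) μ) {r : ℝ} (hr : 0 < r) :
    μ {z : Ed d | r < ‖z‖} < ⊤ := by
  have hε : 0 < min (r ^ 2) 1 := by positivity
  refine (measure_mono fun z (hz : r < ‖z‖) => ?_).trans_lt (hμ.measure_ge_lt_top hε)
  exact min_le_min_right _ (pow_le_pow_left₀ hr.le hz.le 2)

theorem norm_le_mul_min_sq {E : Type*} [SeminormedAddCommGroup E] {dx : ℝ} (hdx : 0 < dx) {z : E}
    (hz : dx / 2 < ‖z‖) (hz1 : ‖z‖ ≤ 1) : ‖z‖ ≤ 2 * dx⁻¹ * min (‖z‖ ^ 2) 1 := by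
  rw [min_eq_left (pow_le_one₀ (norm_nonneg z) hz1), mul_assoc, inv_mul_eq_div, mul_div_assoc',
    le_div_iff₀ hdx]
  nlinarith [norm_nonneg z]

theorem abs_gam_le {d : ℕ} {dx : ℝ} (hdx : 0 < dx) {μ : Measure (Ed d)}
    (hμ : Integrable (fun z : Ed d => min (‖z‖ ^ 2) 1) μ) (l : Fin d) :
    |gam d dx μ l| ≤ 2 * dx⁻¹ * ∫ z, min (‖z‖ ^ 2) 1 ∂μ := by
  have hS : MeasurableSet {z : Ed d | dx / 2 < ‖z‖ ∧ ‖z‖ ≤ 1} :=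
    (measurableSet_lt measurable_const measurable_norm).inter
      (measurableSet_le measurable_norm measurable_const)
  rw [gam, abs_neg, ← Real.norm_eq_abs, ← integral_const_mul]
  have hμ' := hμ.const_mul (2 * dx⁻¹)
  refine (norm_integral_le_of_norm_le hμ'.integrableOn
    ((ae_restrict_iff' hS).2 (.of_forall fun z hz => ?_))).trans
    (setIntegral_le_integral hμ' (.of_forall fun z => by positivity))
  exact (PiLp.norm_apply_le z l).trans (norm_le_mul_min_sq hdx hz.1 hz.2)

theorem integral_abs_Dup_le {d : ℕ} {dx : ℝ} (hdx : 0 < dx) (μ : Measure (Ed d)) (l : Fin d)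
    {w : Ed d → ℝ} (hw : Integrable w) {K : ℝ}
    (hK : ∀ h : Ed d, ∫ x, |w (x + h) - w x| ≤ K * ‖h‖) :
    Integrable (Dup d dx μ l w) ∧ ∫ x, |Dup d dx μ l w x| ≤ K := by
  have hn : ‖(EuclideanSpace.single l dx : Ed d)‖ = dx := by simp [abs_of_pos hdx]
  unfold Dup
  split_ifs
  · refine ⟨((hw.comp_add_right _).sub hw).div_const dx, ?_⟩
    simp only [abs_div, abs_of_pos hdx]
    rw [integral_div, div_le_iff₀ hdx]
    simpa only [hn] using hK (EuclideanSpace.single l dx)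
  · refine ⟨(hw.sub (hw.comp_sub_right _)).div_const dx, ?_⟩
    simp only [abs_div, abs_of_pos hdx]
    rw [integral_div, div_le_iff₀ hdx]
    simpa only [norm_neg, hn, abs_sub_comm, ← sub_eq_add_neg] using
      hK (-EuclideanSpace.single l dx)

theorem integral_abs_large_jumps_le {d : ℕ} {dx : ℝ} (hdx : 0 < dx) (hdx1 : dx < 1)
    {μ : Measure (Ed d)} (hμ : Integrable (fun z : Ed d => min (‖z‖ ^ 2) 1) μ)
    {w : Ed d → ℝ} (hw : Integrable w) {K : ℝ} (hK0 : 0 ≤ K)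
    (hK : ∀ h : Ed d, ∫ x, |w (x + h) - w x| ≤ K * ‖h‖) :
    Integrable (fun x => ∫ z in {z : Ed d | dx / 2 < ‖z‖}, (w (x + z) - w x) ∂μ) ∧
      ∫ x, |∫ z in {z : Ed d | dx / 2 < ‖z‖}, (w (x + z) - w x) ∂μ| ≤
        2 * (K + ∫ x, |w x|) * dx⁻¹ * ∫ z, min (‖z‖ ^ 2) 1 ∂μ := by
  have hS : MeasurableSet {z : Ed d | dx / 2 < ‖z‖} :=
    measurableSet_lt measurable_const measurable_norm
  have : IsFiniteMeasure (μ.restrict {z : Ed d | dx / 2 < ‖z‖}) :=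
    isFiniteMeasure_restrict.2 (measure_norm_gt_lt_top hμ (half_pos hdx)).ne
  obtain ⟨hi, hle⟩ :=
    integral_abs_integral_translate_sub_le (μ.restrict {z : Ed d | dx / 2 < ‖z‖}) hw
  refine ⟨hi, hle.trans ?_⟩
  have hW : 0 ≤ ∫ x, |w x| := integral_nonneg fun x => abs_nonneg _
  have hinv : 1 ≤ dx⁻¹ := (one_le_inv₀ hdx).2 hdx1.le
  have hμ' := hμ.const_mul (2 * (K + ∫ x, |w x|) * dx⁻¹)
  rw [← integral_const_mul]
  refine (setIntegral_mono_on (integrable_prod_translate_sub _ hw).abs.integral_prod_left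
    hμ'.integrableOn hS fun z hz => ?_).trans
    (setIntegral_le_integral hμ' (.of_forall fun z => by positivity))
  rcases le_or_gt ‖z‖ 1 with hz1 | hz1
  · calc ∫ x, |w (x + z) - w x| ≤ K * ‖z‖ := hK z
      _ ≤ (K + ∫ x, |w x|) * (2 * dx⁻¹ * min (‖z‖ ^ 2) 1) := by
        gcongr
        · linarith
        · exact norm_le_mul_min_sq hdx hz hz1
      _ = 2 * (K + ∫ x, |w x|) * dx⁻¹ * min (‖z‖ ^ 2) 1 := by ring
  · rw [min_eq_right (one_le_pow₀ hz1.le), mul_one]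
    calc ∫ x, |w (x + z) - w x| ≤ 2 * ∫ x, |w x| := integral_abs_translate_sub_le hw z
      _ ≤ 2 * (K + ∫ x, |w x|) := by linarith
      _ ≤ 2 * (K + ∫ x, |w x|) * dx⁻¹ := le_mul_of_one_le_right (by positivity) hinv

theorem stmt15 (d : ℕ) (hd : 1 ≤ d) :
    ∃ C : ℝ, 0 < C ∧
      ∀ (dx : ℝ), 0 < dx → dx < 1 →
      ∀ (μ : Measure (Ed d)), μ {0} = 0 →
        (∫⁻ z, ENNReal.ofReal (min (‖z‖ ^ 2) 1) ∂μ < ⊤) →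
      ∀ (w : Ed d → ℝ), Integrable w volume →
      ∀ K : ℝ, 0 ≤ K → (∀ h : Ed d, (∫ x, |w (x + h) - w x|) ≤ K * ‖h‖) →
        Integrable (Lhat d dx μ w) volume ∧
          (∫ x, |Lhat d dx μ w x|) ≤
            C * (K + ∫ x, |w x|) * dx⁻¹ *
              (∫⁻ z, ENNReal.ofReal (min (‖z‖ ^ 2) 1) ∂μ).toReal := by
  refine ⟨2 + 2 * d, by positivity, fun dx hdx hdx1 μ _ hμ w hw K hK0 hK => ?_⟩
  have hμi := integrable_min_sq hμ
  rw [← integral_eq_lintegral_of_nonneg_ae (.of_forall fun z => by positivity)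
    hμi.aestronglyMeasurable]
  set M := ∫ z, min (‖z‖ ^ 2) 1 ∂μ
  have hM : 0 ≤ M := integral_nonneg fun z => by positivity
  have hW : 0 ≤ ∫ x, |w x| := integral_nonneg fun x => abs_nonneg _
  obtain ⟨hJ, hJle⟩ := integral_abs_large_jumps_le hdx hdx1 hμi hw hK0 hK
  have hD := fun l => integral_abs_Dup_le hdx μ l hw hK
  have hDi : ∀ l ∈ Finset.univ, Integrable fun x => |gam d dx μ l| * |Dup d dx μ l w x| :=
    fun l _ => (hD l).1.abs.const_mul _
  have hL : Integrable (Lhat d dx μ w) :=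
    hJ.add (integrable_finsetSum _ fun l _ => (hD l).1.const_mul _)
  refine ⟨hL, ?_⟩
  calc ∫ x, |Lhat d dx μ w x|
      ≤ ∫ x, (|∫ z in {z : Ed d | dx / 2 < ‖z‖}, (w (x + z) - w x) ∂μ| +
          ∑ l : Fin d, |gam d dx μ l| * |Dup d dx μ l w x|) := by
        refine integral_mono hL.abs (hJ.abs.add (integrable_finsetSum _ hDi)) fun x => ?_
        refine (abs_add_le _ _).trans (add_le_add_right ?_ _)
        exact (Finset.abs_sum_le_sum_abs _ _).trans_eq (by simp only [abs_mul])
    _ = (∫ x, |∫ z in {z : Ed d | dx / 2 < ‖z‖}, (w (x + z) - w x) ∂μ|) +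
          ∑ l : Fin d, |gam d dx μ l| * ∫ x, |Dup d dx μ l w x| := by
        rw [integral_add hJ.abs (integrable_finsetSum _ hDi), integral_finsetSum _ hDi]
        simp only [integral_const_mul]
    _ ≤ 2 * (K + ∫ x, |w x|) * dx⁻¹ * M + ∑ _l : Fin d, 2 * dx⁻¹ * M * (K + ∫ x, |w x|) := by
        gcongr with l
        · exact abs_gam_le hdx hμi l
        · exact (hD l).2.trans (le_add_of_nonneg_right hW)
    _ = (2 + 2 * d) * (K + ∫ x, |w x|) * dx⁻¹ * M := by
        rw [Finset.sum_const, Finset.card_univ, Fintype.card_fin, nsmul_eq_mul]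
        ring
end
end
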